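/- arXiv:0810.5728 — 2 statements merged into one kernel-verified Lean document; each statement's English description precedes it below -/
import Mathlib

section
/- Let M be a cleaned-up MDP with target sets F_1,…,F_k ⊆ V, F = ∪_i F_i, every state of F absorbing, let α be an initial distribution supported on V∖F, and let r ∈ [0,1]^k. Then there exists a strategy σ with Pr^σ_α(◇F_i) ≥ r_i for all i = 1,…,k if and only if there exists a strategy σ' with Pr^{σ'}_α(◇F_i) ≥ r_i for all i and additionally Pr^{σ'}_v(◇F) > 0 for every state v ∈ V. Moreover, if σ can be taken memoryless then σ' can be taken memoryless as well. -/
open scoped BigOperators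
open MeasureTheory

/-- A finite-state Markov decision process: a finite set of states `V`, a finite
action alphabet `A`, a nonempty set of enabled actions at each state, and for each
state and enabled action a probability distribution on next states. -/
structure MDP (V A : Type) [Fintype V] [Fintype A] where
  enabled : V → Finset A
  enabled_nonempty : ∀ v, (enabled v).Nonempty
  p : V → A → V → ℝ
  p_nonneg : ∀ v a v', 0 ≤ p v a v'
  p_sum : ∀ v, ∀ a ∈ enabled v, ∑ v', p v a v' = 1

namespace MDP

variable {V A : Type} [Fintype V] [Fintype A]

/-- A (history-dependent, randomized) strategy: given the list of past
(state, action) pairs (most recent first) and the current state, a probability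
distribution on actions, supported on the enabled actions. -/
structure Strategy (M : MDP V A) where
  act : List (V × A) → V → A → ℝ
  act_nonneg : ∀ h v a, 0 ≤ act h v a
  act_support : ∀ h v a, a ∉ M.enabled v → act h v a = 0
  act_sum : ∀ h v, ∑ a, act h v a = 1

/-- A strategy is memoryless (stationary) if it depends only on the current state. -/
def Strategy.Memoryless {M : MDP V A} (σ : M.Strategy) : Prop :=
  ∀ h h' v, σ.act h v = σ.act h' v

/-- A strategy is pure (deterministic) if it always plays a single action with
probability 1. -/
def Strategy.Pure {M : MDP V A} (σ : M.Strategy) : Prop :=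
  ∀ h v, ∃ a, σ.act h v a = 1

/-- `α` is a probability distribution on `V`. -/
def IsDist (α : V → ℝ) : Prop :=
  (∀ v, 0 ≤ α v) ∧ ∑ v, α v = 1

/-- The point (Dirac) distribution at `u`. -/
def diracD [DecidableEq V] (u : V) : V → ℝ := fun v => if v = u then 1 else 0

/-- The `m`-th binary digit of `x`. -/
noncomputable def bit (m : ℕ) (x : ℝ) : ℝ :=
  if ⌊x * 2 ^ (m + 1)⌋ % 2 = 1 then 1 else 0

/-- Extracts from a single seed `x ∈ [0,1]` a sequence of independent uniform
`[0,1]` samples, by splitting the binary digits of `x`. -/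
noncomputable def unif (k : ℕ) (x : ℝ) : ℝ :=
  ∑' n : ℕ, bit (Nat.pair k n) x / 2 ^ (n + 1)

/-- Inverse-CDF sampling from a distribution `q` on a finite type, using the
uniform sample `u`. -/
noncomputable def sample {S : Type} [Fintype S] [Nonempty S] (q : S → ℝ) (u : ℝ) : S :=
  let e := Fintype.equivFin S
  if h : (Finset.univ.filter fun i => u < ∑ j ∈ Finset.Iic i, q (e.symm j)).Nonempty then
    e.symm ((Finset.univ.filter fun i => u < ∑ j ∈ Finset.Iic i, q (e.symm j)).min' h)
  else Classical.arbitrary S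

variable [Nonempty V] [Nonempty A]

/-- The random run of `M` under strategy `σ` from initial distribution `α`, driven by
the random seed `x`: at time `n` it returns the list of past (state, action) pairs
(most recent first) together with the current state and the action chosen there. -/
noncomputable def run (M : MDP V A) (σ : M.Strategy) (α : V → ℝ) (x : ℝ) :
    ℕ → List (V × A) × (V × A)
  | 0 =>
      let s := sample α (unif 0 x)
      ([], (s, sample (σ.act [] s) (unif 1 x)))
  | n + 1 =>
      let r := run M σ α x n
      let s' := sample (M.p r.2.1 r.2.2) (unif (2 * n + 2) x)
      (r.2 :: r.1, (s', sample (σ.act (r.2 :: r.1) s') (unif (2 * n + 3) x)))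

/-- The state at time `n` of the run driven by seed `x`. -/
noncomputable def stateAt (M : MDP V A) (σ : M.Strategy) (α : V → ℝ) (x : ℝ) (n : ℕ) : V :=
  (M.run σ α x n).2.1

/-- The probability, under strategy `σ` from initial distribution `α`, that the
infinite trajectory of states belongs to the event `E`. -/
noncomputable def PrEvent (M : MDP V A) (σ : M.Strategy) (α : V → ℝ) (E : Set (ℕ → V)) : ℝ :=
  (volume {x : ℝ | x ∈ Set.Icc (0 : ℝ) 1 ∧ M.stateAt σ α x ∈ E}).toReal

/-- The probability of eventually visiting the set `F` (the event `◇F`). -/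
noncomputable def PrReach (M : MDP V A) (σ : M.Strategy) (α : V → ℝ) (F : Set V) : ℝ :=
  M.PrEvent σ α {w | ∃ n, w n ∈ F}

/-- A state is absorbing if it has a single enabled action, which loops on it with
probability 1. -/
def Absorbing (M : MDP V A) (v : V) : Prop :=
  ∃ a, M.enabled v = {a} ∧ M.p v a v = 1

/-- One positive-probability step of the underlying graph of the MDP. -/
def Step (M : MDP V A) (v v' : V) : Prop :=
  ∃ a ∈ M.enabled v, 0 < M.p v a v'

/-- The MDP is cleaned-up w.r.t. `F`: from every state there is a path of
positive-probability transitions reaching `F`. -/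
def CleanedUp (M : MDP V A) (F : Set V) : Prop :=
  ∀ v, ∃ w ∈ F, Relation.ReflTransGen M.Step v w

end MDP

namespace MDP

section Seed

lemma bit_eq_zero_or_one (m : ℕ) (x : ℝ) : bit m x = 0 ∨ bit m x = 1 := by
  unfold bit; split_ifs <;> simp

lemma bit_nonneg (m : ℕ) (x : ℝ) : 0 ≤ bit m x := by
  rcases bit_eq_zero_or_one m x with h | h <;> simp [h]

lemma bit_le_one (m : ℕ) (x : ℝ) : bit m x ≤ 1 := by
  rcases bit_eq_zero_or_one m x with h | h <;> simp [h]

lemma measurable_bit (m : ℕ) : Measurable (bit m) := by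
  have hfloor : Measurable fun x : ℝ => ⌊x * 2 ^ (m + 1)⌋ :=
    Int.measurable_floor.comp (measurable_id.mul_const _)
  exact (measurable_from_top (f := fun z : ℤ => if z % 2 = 1 then (1 : ℝ) else 0)).comp hfloor

/-- Adding `2⁻ᵐ⁻¹` flips the `m`-th binary digit. -/
lemma bit_add_self (m : ℕ) (y : ℝ) (h : bit m (y + 1 / 2 ^ (m + 1)) = 1) : bit m y = 0 := by
  unfold bit at *
  have e : (y + 1 / 2 ^ (m + 1)) * 2 ^ (m + 1) = y * 2 ^ (m + 1) + 1 := by field_simp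
  rw [e, Int.floor_add_one] at h
  split_ifs at * <;> first | rfl | (exfalso; omega) | norm_num at h

/-- Adding `2⁻ᵐ⁻¹` does not affect the later binary digits. -/
lemma bit_add_of_lt {m m' : ℕ} (hm : m < m') (y : ℝ) :
    bit m' (y + 1 / 2 ^ (m + 1)) = bit m' y := by
  unfold bit
  obtain ⟨d, rfl⟩ := Nat.exists_eq_add_of_lt hm
  have e : (y + 1 / 2 ^ (m + 1)) * 2 ^ (m + d + 1 + 1)
      = y * 2 ^ (m + d + 1 + 1) + ((2 * 2 ^ d : ℤ) : ℝ) := by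
    push_cast
    field_simp
    ring
  rw [e, Int.floor_add_intCast, Int.add_mul_emod_self_left]

/-- The reals whose binary digits along an infinite set of positions are all `1` form a
null set: its translates by the corresponding powers of two are pairwise disjoint. -/
lemma volume_forall_bit_eq_one {g : ℕ → ℕ} (hg : Function.Injective g) :
    volume {x : ℝ | ∀ n, bit (g n) x = 1} = 0 := by
  have hdisj : ∀ a b : ℕ, g a < g b → ∀ y : ℝ,
      (∀ n, bit (g n) (y + 1 / 2 ^ (g a + 1)) = 1) →
      (∀ n, bit (g n) (y + 1 / 2 ^ (g b + 1)) = 1) → False := by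
    intro a b hab y ha hb
    have h1 := ha b
    rw [bit_add_of_lt hab, bit_add_self _ _ (hb b)] at h1
    norm_num at h1
  refine Measure.addHaar_eq_zero_of_disjoint_translates volume
    (fun n => -(1 / 2 ^ (g n + 1) : ℝ)) ?_ ?_ ?_
  · refine (Metric.isBounded_Icc (-1 : ℝ) 0).subset ?_
    rintro _ ⟨n, rfl⟩
    have h1 : (1 : ℝ) / 2 ^ (g n + 1) ≤ 1 := by
      rw [div_le_one (by positivity)]
      exact one_le_pow₀ (by norm_num)
    have h2 : (0 : ℝ) ≤ 1 / 2 ^ (g n + 1) := by positivity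
    simp only [Set.mem_Icc]
    constructor <;> linarith
  · intro a b hab
    rw [Function.onFun, Set.disjoint_left]
    intro y hya hyb
    simp only [Set.singleton_add, Set.image_add_left, Set.mem_preimage, Set.mem_ofPred_eq,
      neg_neg] at hya hyb
    simp only [add_comm _ y] at hya hyb
    rcases lt_or_gt_of_ne (hg.ne hab) with h | h
    · exact hdisj a b h y hya hyb
    · exact hdisj b a h y hyb hya
  · rw [Set.ofPred_forall]
    exact MeasurableSet.iInter fun n => measurable_bit (g n) (measurableSet_singleton 1)

lemma summable_geometric_succ : Summable fun n : ℕ => (1 : ℝ) / 2 ^ (n + 1) := by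
  simpa [pow_succ, div_eq_mul_inv, mul_comm] using summable_geometric_two.mul_left (1 / 2 : ℝ)

lemma tsum_geometric_succ : ∑' n : ℕ, (1 : ℝ) / 2 ^ (n + 1) = 1 := by
  have h : ∀ n : ℕ, (1 : ℝ) / 2 ^ (n + 1) = 1 / 2 * (1 / 2) ^ n := fun n => by
    rw [one_div_pow, pow_succ]; field_simp
  simp_rw [h, tsum_mul_left, tsum_geometric_two]
  norm_num

lemma bit_div_le (m n : ℕ) (x : ℝ) : bit m x / 2 ^ (n + 1) ≤ 1 / 2 ^ (n + 1) := by
  have := bit_le_one m x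
  gcongr

lemma summable_unif (k : ℕ) (x : ℝ) :
    Summable fun n : ℕ => bit (Nat.pair k n) x / 2 ^ (n + 1) :=
  summable_geometric_succ.of_nonneg_of_le
    (fun n => div_nonneg (bit_nonneg _ _) (by positivity)) (fun n => bit_div_le _ n x)

lemma unif_nonneg (k : ℕ) (x : ℝ) : 0 ≤ unif k x :=
  tsum_nonneg fun n => div_nonneg (bit_nonneg _ _) (by positivity)

lemma unif_lt_one {k n : ℕ} {x : ℝ} (h : bit (Nat.pair k n) x ≠ 1) : unif k x < 1 := by
  rw [← tsum_geometric_succ]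
  refine (summable_unif k x).tsum_lt_tsum (i := n) (fun m => bit_div_le _ m x) ?_
    summable_geometric_succ
  rw [(bit_eq_zero_or_one _ _).resolve_right h, zero_div]
  positivity

lemma volume_exists_one_le_unif : volume {x : ℝ | ∃ k, 1 ≤ unif k x} = 0 := by
  rw [Set.ofPred_exists, measure_iUnion_null_iff]
  intro k
  refine measure_mono_null ?_ (volume_forall_bit_eq_one (g := Nat.pair k)
    fun a b h => (Nat.pair_eq_pair.1 h).2)
  intro x hx n
  by_contra h
  exact absurd hx (not_le.2 (unif_lt_one h))

lemma sum_bit (L : ℕ) {u : ℝ} (hu : u ∈ Set.Ico (0 : ℝ) 1) :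
    ∑ n ∈ Finset.range L, bit n u / 2 ^ (n + 1) = (⌊u * 2 ^ L⌋ : ℝ) / 2 ^ L := by
  induction L with
  | zero =>
    have h : ⌊u⌋ = 0 := Int.floor_eq_zero_iff.2 hu
    simp [h]
  | succ L ih =>
    rw [Finset.sum_range_succ, ih]
    have hb : bit L u = ((⌊u * 2 ^ (L + 1)⌋ % 2 : ℤ) : ℝ) := by
      unfold bit
      rcases Int.emod_two_eq_zero_or_one ⌊u * 2 ^ (L + 1)⌋ with h | h <;> simp [h]
    have hd : ⌊u * 2 ^ L⌋ = ⌊u * 2 ^ (L + 1)⌋ / 2 := by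
      have h1 := Int.floor_le (u * 2 ^ L)
      have h2 := Int.lt_floor_add_one (u * 2 ^ L)
      have h3 : 2 * ⌊u * 2 ^ L⌋ ≤ ⌊u * 2 ^ (L + 1)⌋ := by
        rw [Int.le_floor]; push_cast; rw [pow_succ]; linarith
      have h4 : ⌊u * 2 ^ (L + 1)⌋ < 2 * ⌊u * 2 ^ L⌋ + 2 := by
        rw [Int.floor_lt]; push_cast; rw [pow_succ]; linarith
      omega
    have he : (⌊u * 2 ^ (L + 1)⌋ : ℝ)
        = 2 * (⌊u * 2 ^ L⌋ : ℝ) + ((⌊u * 2 ^ (L + 1)⌋ % 2 : ℤ) : ℝ) := by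
      rw [hd]; exact_mod_cast (Int.mul_ediv_add_emod _ _).symm
    rw [hb, he, pow_succ]
    field_simp

/-- If the first `L` digits of the `k`-th sample agree with those of `u`, then the sample is
within `2⁻ᴸ` of `u`. -/
lemma abs_unif_sub_le {k L : ℕ} {x u : ℝ} (hu : u ∈ Set.Ico (0 : ℝ) 1)
    (h : ∀ n < L, bit (Nat.pair k n) x = bit n u) : |unif k x - u| ≤ 1 / 2 ^ L := by
  have hsplit := (summable_unif k x).sum_add_tsum_nat_add L
  have hhead : ∑ n ∈ Finset.range L, bit (Nat.pair k n) x / 2 ^ (n + 1)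
      = (⌊u * 2 ^ L⌋ : ℝ) / 2 ^ L := by
    rw [← sum_bit L hu]
    exact Finset.sum_congr rfl fun n hn => by rw [h n (Finset.mem_range.1 hn)]
  have htail0 : 0 ≤ ∑' n : ℕ, bit (Nat.pair k (n + L)) x / 2 ^ (n + L + 1) :=
    tsum_nonneg fun n => div_nonneg (bit_nonneg _ _) (by positivity)
  have htail1 : ∑' n : ℕ, bit (Nat.pair k (n + L)) x / 2 ^ (n + L + 1) ≤ 1 / 2 ^ L := by
    calc ∑' n : ℕ, bit (Nat.pair k (n + L)) x / 2 ^ (n + L + 1)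
        ≤ ∑' n : ℕ, 1 / 2 ^ L * (1 / 2 ^ (n + 1)) := by
          refine Summable.tsum_le_tsum (fun n => ?_)
            ((summable_nat_add_iff L).2 (summable_unif k x))
            (summable_geometric_succ.mul_left _)
          refine (bit_div_le _ (n + L) x).trans_eq ?_
          field_simp
          ring
      _ = 1 / 2 ^ L := by rw [tsum_mul_left, tsum_geometric_succ, mul_one]
  have h1 : (⌊u * 2 ^ L⌋ : ℝ) / 2 ^ L ≤ u := by
    rw [div_le_iff₀ (by positivity)]; exact Int.floor_le _
  have h2 : u ≤ (⌊u * 2 ^ L⌋ : ℝ) / 2 ^ L + 1 / 2 ^ L := by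
    rw [← add_div, le_div_iff₀ (by positivity)]; exact (Int.lt_floor_add_one _).le
  rw [hhead] at hsplit
  rw [abs_le]
  unfold unif
  constructor <;> linarith

/-- Prescribing finitely many binary digits cuts out a dyadic interval. -/
lemma exists_Ico_bit_eq (β : ℕ → ℕ) (hβ : ∀ m, β m = 0 ∨ β m = 1) (K : ℕ) :
    ∃ i : ℕ, i + 1 ≤ 2 ^ K ∧ ∀ x ∈ Set.Ico ((i : ℝ) / 2 ^ K) ((i + 1) / 2 ^ K),
      ∀ m < K, bit m x = β m := by
  induction K with
  | zero => exact ⟨0, by simp⟩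
  | succ K ih =>
    obtain ⟨i, hi, h⟩ := ih
    have hβK : β K ≤ 1 := by rcases hβ K with h | h <;> omega
    refine ⟨2 * i + β K, by rw [pow_succ]; omega, ?_⟩
    rintro x ⟨hx1, hx2⟩ m hm
    rw [div_le_iff₀ (by positivity)] at hx1
    rw [lt_div_iff₀ (by positivity)] at hx2
    push_cast at hx1 hx2
    have hb0 : (0 : ℝ) ≤ β K := by positivity
    have hb1 : (β K : ℝ) ≤ 1 := by exact_mod_cast hβK
    rcases Nat.lt_succ_iff_lt_or_eq.1 hm with hm | rfl
    · refine h x ⟨?_, ?_⟩ m hm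
      · rw [div_le_iff₀ (by positivity)]; rw [pow_succ] at hx1; linarith
      · rw [lt_div_iff₀ (by positivity)]; rw [pow_succ] at hx2; linarith
    · have hfl : ⌊x * 2 ^ (m + 1)⌋ = 2 * (i : ℤ) + β m := by
        rw [Int.floor_eq_iff]; push_cast; exact ⟨hx1, hx2⟩
      unfold bit
      rw [hfl]
      rcases hβ m with h0 | h0 <;> simp [h0, Int.add_emod]

/-- Finitely many samples lie near prescribed values with positive probability. -/
lemma volume_unif_near_pos (u : ℕ → ℝ) (hu : ∀ j, u j ∈ Set.Ico (0 : ℝ) 1) (N : ℕ)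
    {ε : ℝ} (hε : 0 < ε) :
    0 < volume {x : ℝ | x ∈ Set.Icc (0 : ℝ) 1 ∧ ∀ j < N, |unif j x - u j| < ε} := by
  obtain ⟨L, hL⟩ := exists_pow_lt_of_lt_one hε (by norm_num : (1 / 2 : ℝ) < 1)
  rw [one_div_pow] at hL
  set β : ℕ → ℕ := fun m => if bit m.unpair.2 (u m.unpair.1) = 1 then 1 else 0 with hβdef
  have hβ : ∀ m, β m = 0 ∨ β m = 1 := fun m => by
    simp only [hβdef]; split_ifs <;> simp
  have hβbit : ∀ j n, (β (Nat.pair j n) : ℝ) = bit n (u j) := fun j n => by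
    rcases bit_eq_zero_or_one n (u j) with h | h <;> simp [hβdef, h]
  obtain ⟨i, hi, h⟩ := exists_Ico_bit_eq β hβ (Nat.pair N L)
  have hi' : ((i : ℝ) + 1) ≤ 2 ^ Nat.pair N L := by exact_mod_cast hi
  have hpos : 0 < volume
      (Set.Ico ((i : ℝ) / 2 ^ Nat.pair N L) ((i + 1) / 2 ^ Nat.pair N L)) := by
    rw [Real.volume_Ico, ENNReal.ofReal_pos, ← sub_div]
    simp
  refine hpos.trans_le (measure_mono ?_)
  intro x hx
  refine ⟨⟨le_trans (by positivity) hx.1, hx.2.le.trans ?_⟩, fun j hj => ?_⟩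
  · rwa [div_le_one (by positivity)]
  · refine (abs_unif_sub_le (hu j) fun n hn => ?_).trans_lt hL
    rw [h x hx _ ((Nat.pair_lt_pair_left n hj).trans (Nat.pair_lt_pair_right N hn)), hβbit]

end Seed

section Sample

variable {S : Type} [Fintype S]

lemma sum_Iic_equivFin (q : S → ℝ) (i : Fin (Fintype.card S)) :
    ∑ j ∈ Finset.Iic i, q ((Fintype.equivFin S).symm j)
      = ∑ j ∈ Finset.Iio i, q ((Fintype.equivFin S).symm j) + q ((Fintype.equivFin S).symm i) := by
  rw [← Finset.Iio_insert, Finset.sum_insert (by simp), add_comm]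

lemma sum_Iic_le_sum_Iio {q : S → ℝ} (h0 : ∀ s, 0 ≤ q s) {i j : Fin (Fintype.card S)}
    (hij : j < i) :
    ∑ l ∈ Finset.Iic j, q ((Fintype.equivFin S).symm l)
      ≤ ∑ l ∈ Finset.Iio i, q ((Fintype.equivFin S).symm l) :=
  Finset.sum_le_sum_of_subset_of_nonneg
    (fun _ hl => Finset.mem_Iio.2 ((Finset.mem_Iic.1 hl).trans_lt hij)) fun _ _ _ => h0 _

lemma isDist_diracD [DecidableEq S] (s : S) : IsDist (diracD s) :=
  ⟨fun v => by unfold diracD; split_ifs <;> norm_num, by simp [diracD]⟩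

variable [Nonempty S]

/-- Sampling only returns outcomes of positive probability. -/
lemma sample_pos {q : S → ℝ} (hq : IsDist q) {u : ℝ} (hu : u ∈ Set.Ico (0 : ℝ) 1) :
    0 < q (sample q u) := by
  set e := Fintype.equivFin S with he
  have hne : (Finset.univ.filter fun i => u < ∑ j ∈ Finset.Iic i, q (e.symm j)).Nonempty := by
    have hcard : 0 < Fintype.card S := Fintype.card_pos
    refine ⟨⟨Fintype.card S - 1, by omega⟩, ?_⟩
    have htop : Finset.Iic (⟨Fintype.card S - 1, by omega⟩ : Fin (Fintype.card S))
        = Finset.univ := by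
      ext j
      have := j.2
      simp only [Finset.mem_Iic, Finset.mem_univ, iff_true, Fin.le_def]
      omega
    rw [Finset.mem_filter, htop, Equiv.sum_comp e.symm q, hq.2]
    exact ⟨Finset.mem_univ _, hu.2⟩
  obtain ⟨i, hs, hlt, hmin⟩ : ∃ i, sample q u = e.symm i ∧
      u < ∑ j ∈ Finset.Iic i, q (e.symm j) ∧
      ∀ l, u < ∑ j ∈ Finset.Iic l, q (e.symm j) → i ≤ l :=
    ⟨_, dif_pos hne, (Finset.mem_filter.1 (Finset.min'_mem _ hne)).2,
      fun l hl => Finset.min'_le _ l (Finset.mem_filter.2 ⟨Finset.mem_univ l, hl⟩)⟩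
  rw [hs]
  rw [sum_Iic_equivFin] at hlt
  suffices ∑ j ∈ Finset.Iio i, q (e.symm j) ≤ u by linarith
  by_cases hi0 : i.1 = 0
  · have hemp : Finset.Iio i = ∅ := by
      ext j
      simp [Fin.lt_def, hi0]
    rw [hemp, Finset.sum_empty]
    exact hu.1
  · have hi2 := i.2
    obtain ⟨j, hj⟩ : ∃ j : Fin (Fintype.card S), j.1 + 1 = i.1 :=
      ⟨⟨i.1 - 1, by omega⟩, by simp only; omega⟩
    have hji : j < i := by rw [Fin.lt_def]; omega
    have hIio : Finset.Iio i = Finset.Iic j := by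
      ext l
      rw [Finset.mem_Iio, Finset.mem_Iic, Fin.lt_def, Fin.le_def]
      omega
    rw [hIio]
    exact not_lt.1 fun hlt' => (hmin j hlt').not_gt hji

/-- Each outcome of positive probability is sampled on a nonempty open interval. -/
lemma exists_near_sample_eq {q : S → ℝ} (hq : IsDist q) {s : S} (hs : 0 < q s) :
    ∃ u ∈ Set.Ico (0 : ℝ) 1, ∃ ε > 0, ∀ y, |y - u| < ε → sample q y = s := by
  set e := Fintype.equivFin S with he
  set i := e s with hi
  set lo := ∑ j ∈ Finset.Iio i, q (e.symm j) with hlo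
  have hsi : e.symm i = s := e.symm_apply_apply s
  have hcdf : ∑ j ∈ Finset.Iic i, q (e.symm j) = lo + q s := by
    rw [sum_Iic_equivFin, hsi]
  have hlo0 : 0 ≤ lo := Finset.sum_nonneg fun _ _ => hq.1 _
  have hle : lo + q s ≤ 1 := by
    rw [← hcdf, ← hq.2, ← Equiv.sum_comp e.symm q]
    exact Finset.sum_le_sum_of_subset_of_nonneg (Finset.subset_univ _) fun _ _ _ => hq.1 _
  refine ⟨lo + q s / 2, ⟨by linarith, by linarith⟩, q s / 2, by linarith, fun y hy => ?_⟩
  rw [abs_lt] at hy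
  have hmem : i ∈ Finset.univ.filter fun i => y < ∑ j ∈ Finset.Iic i, q (e.symm j) := by
    rw [Finset.mem_filter, hcdf]
    exact ⟨Finset.mem_univ _, by linarith⟩
  have hsample : sample q y = e.symm (Finset.min' _ ⟨i, hmem⟩) := dif_pos ⟨i, hmem⟩
  have hmin : Finset.min' _ ⟨i, hmem⟩ = i := by
    refine le_antisymm (Finset.min'_le _ _ hmem) (Finset.le_min' _ _ _ fun j hj => ?_)
    by_contra hji
    have h1 := (Finset.mem_filter.1 hj).2
    have h2 := sum_Iic_le_sum_Iio hq.1 (not_le.1 hji)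
    linarith
  rw [hsample, hmin, hsi]

end Sample

section Strategies

variable {V A : Type} [Fintype V] [Fintype A] {M : MDP V A}

lemma Strategy.isDist_act (σ : M.Strategy) (h : List (V × A)) (v : V) : IsDist (σ.act h v) :=
  ⟨σ.act_nonneg h v, σ.act_sum h v⟩

lemma Strategy.mem_enabled (σ : M.Strategy) {h : List (V × A)} {v : V} {a : A}
    (ha : 0 < σ.act h v a) : a ∈ M.enabled v := by
  by_contra hn
  exact ha.ne' (σ.act_support h v a hn)

lemma isDist_p {v : V} {a : A} (ha : a ∈ M.enabled v) : IsDist (M.p v a) :=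
  ⟨M.p_nonneg v a, M.p_sum v a ha⟩

/-- `σ.Live F h v`: after the history `h` ending in `v`, the strategy `σ` visits `F` with
positive probability. -/
inductive Strategy.Live (σ : M.Strategy) (F : Set V) : List (V × A) → V → Prop
  | base {h : List (V × A)} {v : V} : v ∈ F → Live σ F h v
  | step {h : List (V × A)} {v : V} {a : A} {v' : V} : 0 < σ.act h v a → 0 < M.p v a v' →
      Live σ F ((v, a) :: h) v' → Live σ F h v

lemma Strategy.Memoryless.live {σ : M.Strategy} (hσ : σ.Memoryless) {F : Set V}
    {h : List (V × A)} {v : V} (hl : σ.Live F h v) (h' : List (V × A)) : σ.Live F h' v := by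
  induction hl generalizing h' with
  | base hv => exact .base hv
  | step ha hp _ ih => exact .step (by rwa [hσ h' _]) hp (ih _)

open Classical in
/-- The strategy that follows `σ` as long as `F` remains reachable under `σ`, and otherwise
plays uniformly among the enabled actions. -/
noncomputable def Strategy.repair (σ : M.Strategy) (F : Set V) : M.Strategy where
  act h v a := if σ.Live F h v then σ.act h v a
    else if a ∈ M.enabled v then ((M.enabled v).card : ℝ)⁻¹ else 0
  act_nonneg h v a := by
    split_ifs
    · exact σ.act_nonneg h v a
    · positivity
    · exact le_rfl
  act_support h v a ha := by
    rw [if_neg ha, σ.act_support h v a ha, ite_self]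
  act_sum h v := by
    split_ifs
    · exact σ.act_sum h v
    · have hc : ((M.enabled v).card : ℝ) ≠ 0 := by
        exact_mod_cast (M.enabled_nonempty v).card_pos.ne'
      rw [Finset.sum_ite_mem, Finset.univ_inter, Finset.sum_const, nsmul_eq_mul,
        mul_inv_cancel₀ hc]

lemma Strategy.repair_act_of_live {σ : M.Strategy} {F : Set V} {h : List (V × A)} {v : V}
    (hl : σ.Live F h v) : (σ.repair F).act h v = σ.act h v := by
  funext a
  exact if_pos hl

lemma Strategy.repair_act_pos {σ : M.Strategy} {F : Set V} {h : List (V × A)} {v : V} {a : A}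
    (hl : ¬ σ.Live F h v) (ha : a ∈ M.enabled v) : 0 < (σ.repair F).act h v a := by
  have hc : 0 < (M.enabled v).card := (M.enabled_nonempty v).card_pos
  simp only [repair, if_neg hl, if_pos ha]
  positivity

lemma Strategy.Memoryless.repair {σ : M.Strategy} (hσ : σ.Memoryless) (F : Set V) :
    (σ.repair F).Memoryless := by
  intro h h' v
  have hlive : σ.Live F h v = σ.Live F h' v :=
    propext ⟨fun hl => hσ.live hl _, fun hl => hσ.live hl _⟩
  funext a
  unfold Strategy.repair
  simp_rw [hσ h h' v]
  congr

lemma Strategy.Live.repair {σ : M.Strategy} {F : Set V} {h : List (V × A)} {v : V}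
    (hl : σ.Live F h v) : (σ.repair F).Live F h v := by
  induction hl with
  | base hv => exact .base hv
  | step ha hp hl ih =>
    exact .step (by rwa [repair_act_of_live (.step ha hp hl)]) hp ih

lemma Strategy.repair_live (σ : M.Strategy) {F : Set V} (hclean : M.CleanedUp F)
    (h : List (V × A)) (v : V) : (σ.repair F).Live F h v := by
  obtain ⟨w, hw, hpath⟩ := hclean v
  induction hpath using Relation.ReflTransGen.head_induction_on generalizing h with
  | refl => exact .base hw
  | @head v c hstep _ ih =>
    by_cases hl : σ.Live F h v
    · exact hl.repair
    · obtain ⟨a, ha, hp⟩ := hstep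
      exact .step (repair_act_pos hl ha) hp (ih _)

variable [Nonempty V] [Nonempty A]

lemma PrReach_le_of_forall {σ σ' : M.Strategy} {α : V → ℝ} {G : Set V}
    (h : ∀ x, (∀ k, unif k x < 1) → ∀ n, M.stateAt σ α x n ∈ G → M.stateAt σ' α x n ∈ G) :
    M.PrReach σ α G ≤ M.PrReach σ' α G := by
  unfold PrReach PrEvent
  refine ENNReal.toReal_mono
    (measure_ne_top_of_subset (fun x hx => hx.1) isCompact_Icc.measure_ne_top) ?_
  refine measure_mono_ae (Filter.eventually_of_mem
    (compl_mem_ae_iff.2 volume_exists_one_le_unif) ?_)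
  rintro x hx ⟨hI, n, hn⟩
  exact ⟨hI, n, h x (fun k => not_le.1 fun hk => hx ⟨k, hk⟩) n hn⟩

lemma act_run_pos (σ : M.Strategy) (α : V → ℝ) {x : ℝ} (hx : ∀ k, unif k x < 1) (n : ℕ) :
    0 < σ.act (M.run σ α x n).1 (M.run σ α x n).2.1 (M.run σ α x n).2.2 := by
  cases n with
  | zero => exact sample_pos (σ.isDist_act _ _) ⟨unif_nonneg _ _, hx _⟩
  | succ n => exact sample_pos (σ.isDist_act _ _) ⟨unif_nonneg _ _, hx _⟩

lemma p_run_pos (σ : M.Strategy) (α : V → ℝ) {x : ℝ} (hx : ∀ k, unif k x < 1) (n : ℕ) :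
    0 < M.p (M.run σ α x n).2.1 (M.run σ α x n).2.2 (M.run σ α x (n + 1)).2.1 :=
  sample_pos (isDist_p (σ.mem_enabled (act_run_pos σ α hx n))) ⟨unif_nonneg _ _, hx _⟩

lemma live_run (σ : M.Strategy) (α : V → ℝ) {F : Set V} {x : ℝ} (hx : ∀ k, unif k x < 1)
    {m n : ℕ} (hmn : m ≤ n) (hn : M.stateAt σ α x n ∈ F) :
    σ.Live F (M.run σ α x m).1 (M.run σ α x m).2.1 := by
  induction hmn using Nat.decreasingInduction with
  | self => exact .base hn
  | of_succ m _ ih => exact .step (act_run_pos σ α hx m) (p_run_pos σ α hx m) ih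

/-- Driven by the same seed, the repaired strategy has the same run until `F` is visited. -/
lemma run_repair (σ : M.Strategy) (α : V → ℝ) {F : Set V} {x : ℝ} (hx : ∀ k, unif k x < 1)
    {m n : ℕ} (hmn : m ≤ n) (hn : M.stateAt σ α x n ∈ F) :
    M.run (σ.repair F) α x m = M.run σ α x m := by
  induction m with
  | zero =>
    have hl := live_run σ α hx hmn hn
    simp only [run] at hl ⊢
    rw [Strategy.repair_act_of_live hl]
  | succ m ih =>
    have hl := live_run σ α hx hmn hn
    simp only [run] at hl ⊢
    rw [ih (by omega), Strategy.repair_act_of_live hl]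

lemma PrReach_le_repair (σ : M.Strategy) (α : V → ℝ) {F G : Set V} (hG : G ⊆ F) :
    M.PrReach σ α G ≤ M.PrReach (σ.repair F) α G :=
  PrReach_le_of_forall fun x hx n hn => by
    unfold stateAt
    rwa [run_repair σ α hx le_rfl (hG hn)]

/-- A live history that is produced on an open box of samples extends to a visit of `F` on an
open box of samples. -/
lemma Strategy.Live.exists_near_reach {σ : M.Strategy} {α : V → ℝ} {F : Set V}
    {h : List (V × A)} {v : V} (hl : σ.Live F h v) {n : ℕ} {u : ℕ → ℝ}
    (hu : ∀ j, u j ∈ Set.Ico (0 : ℝ) 1) {ε : ℝ} (hε : 0 < ε)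
    (hrun : ∀ x, (∀ j < 2 * n + 1, |unif j x - u j| < ε) →
      (M.run σ α x n).1 = h ∧ (M.run σ α x n).2.1 = v) :
    ∃ (N : ℕ) (u' : ℕ → ℝ) (ε' : ℝ), (∀ j, u' j ∈ Set.Ico (0 : ℝ) 1) ∧ 0 < ε' ∧
      ∀ x, (∀ j < N, |unif j x - u' j| < ε') → ∃ m, M.stateAt σ α x m ∈ F := by
  induction hl generalizing n u ε with
  | base hv =>
    refine ⟨2 * n + 1, u, ε, hu, hε, fun x hx => ⟨n, ?_⟩⟩
    unfold stateAt
    rwa [(hrun x hx).2]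
  | @step h v a v' ha hp _ ih =>
    obtain ⟨ua, hua, εa, hεa, hsa⟩ := exists_near_sample_eq (σ.isDist_act h v) ha
    obtain ⟨up, hup, εp, hεp, hsp⟩ := exists_near_sample_eq (isDist_p (σ.mem_enabled ha)) hp
    refine ih (n := n + 1)
      (u := fun j => if j < 2 * n + 1 then u j else if j = 2 * n + 1 then ua else up)
      (fun j => ?_) (lt_min hε (lt_min hεa hεp)) fun x hx => ?_
    · split_ifs
      · exact hu j
      · exact hua
      · exact hup
    · simp only [lt_min_iff] at hx
      obtain ⟨h1, h2⟩ := hrun x fun j hj => by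
        simpa only [if_pos hj] using (hx j (by omega)).1
      have hact : |unif (2 * n + 1) x - ua| < εa := by
        simpa using (hx (2 * n + 1) (by omega)).2.1
      have htrans : |unif (2 * n + 2) x - up| < εp := by
        simpa using (hx (2 * n + 2) (by omega)).2.2
      have h3 : (M.run σ α x n).2.2 = a := by
        have : (M.run σ α x n).2.2
            = sample (σ.act (M.run σ α x n).1 (M.run σ α x n).2.1) (unif (2 * n + 1) x) := by
          cases n <;> rfl
        rw [this, h1, h2, hsa _ hact]
      have h23 : (M.run σ α x n).2 = (v, a) := Prod.ext h2 h3
      refine ⟨?_, ?_⟩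
      · simp only [run, h23, h1]
      · simp only [run, h23]
        exact hsp _ htrans

lemma Strategy.Live.PrReach_pos [DecidableEq V] {σ : M.Strategy} {F : Set V} {v : V}
    (hl : σ.Live F [] v) : 0 < M.PrReach σ (diracD v) F := by
  obtain ⟨u, hu, ε, hε, hs⟩ := exists_near_sample_eq (isDist_diracD v) (s := v)
    (by simp [diracD])
  obtain ⟨N, u', ε', hu', hε', h⟩ := hl.exists_near_reach (α := diracD v) (n := 0)
    (u := fun _ => u) (fun _ => hu) hε fun x hx => ⟨rfl, hs _ (hx 0 (by norm_num))⟩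
  unfold PrReach PrEvent
  refine ENNReal.toReal_pos (ne_of_gt ?_)
    (measure_ne_top_of_subset (fun x hx => hx.1) isCompact_Icc.measure_ne_top)
  exact (volume_unif_near_pos u' hu' N hε').trans_le
    (measure_mono fun x hx => ⟨hx.1, h x hx.2⟩)

end Strategies

end MDP

open MDP in
/-- For a cleaned-up MDP with absorbing targets `F_1, …, F_k` and initial distribution
`α` supported on `V ∖ F`, a vector `r ∈ [0,1]^k` is achievable iff it is achievable by
a strategy that moreover reaches `F` with positive probability from every state; and
likewise for memoryless strategies. -/
theorem achievable_iff_achievable_with_pos_reach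
    {V A : Type} [Fintype V] [Fintype A] [Nonempty V] [Nonempty A] [DecidableEq V]
    (M : MDP V A) {k : ℕ} (Fi : Fin k → Finset V) (F : Finset V)
    (hF : F = Finset.univ.biUnion Fi)
    (habs : ∀ v ∈ F, M.Absorbing v)
    (hclean : M.CleanedUp (↑F : Set V))
    (α : V → ℝ) (hα : IsDist α) (hsupp : ∀ v ∈ F, α v = 0)
    (r : Fin k → ℝ) (hr : ∀ i, 0 ≤ r i ∧ r i ≤ 1) :
    ((∃ σ : M.Strategy, ∀ i, r i ≤ M.PrReach σ α (↑(Fi i) : Set V)) ↔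
      (∃ σ' : M.Strategy, (∀ i, r i ≤ M.PrReach σ' α (↑(Fi i) : Set V)) ∧
        ∀ v : V, 0 < M.PrReach σ' (diracD v) (↑F : Set V))) ∧
    ((∃ σ : M.Strategy, σ.Memoryless ∧ ∀ i, r i ≤ M.PrReach σ α (↑(Fi i) : Set V)) ↔
      (∃ σ' : M.Strategy, σ'.Memoryless ∧
        (∀ i, r i ≤ M.PrReach σ' α (↑(Fi i) : Set V)) ∧
        ∀ v : V, 0 < M.PrReach σ' (diracD v) (↑F : Set V))) := by
  have hsub : ∀ i, (↑(Fi i) : Set V) ⊆ (↑F : Set V) := fun i => by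
    rw [hF, Finset.coe_subset]
    exact Finset.subset_biUnion_of_mem Fi (Finset.mem_univ i)
  refine ⟨⟨?_, fun ⟨σ', h, _⟩ => ⟨σ', h⟩⟩, ⟨?_, fun ⟨σ', hm, h, _⟩ => ⟨σ', hm, h⟩⟩⟩
  · rintro ⟨σ, h⟩
    exact ⟨σ.repair F, fun i => (h i).trans (PrReach_le_repair σ α (hsub i)),
      fun v => (σ.repair_live hclean [] v).PrReach_pos⟩
  · rintro ⟨σ, hm, h⟩
    exact ⟨σ.repair F, hm.repair F, fun i => (h i).trans (PrReach_le_repair σ α (hsub i)),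
      fun v => (σ.repair_live hclean [] v).PrReach_pos⟩
end

section
/- Let M be an MDP with target sets F_1,…,F_k, F = ∪_i F_i, every state of F absorbing, α an initial distribution on V∖F, and let σ be a memoryless strategy with Pr^σ_v(◇F) > 0 for every state v. Let y'_{(v,γ)} = Σ_{v'∈V∖F} α(v') Σ_{n=0}^∞ (P^σ)^n_{v',v} σ(v)(γ) be the expected number of visits to v at which action γ is chosen. Then for every v ∈ F, the probability of ever reaching v satisfies Pr^σ_α(◇{v}) = Σ_{v'∈V∖F} Σ_{γ'∈Γ_{v'}} p_{(v',γ',v)} y'_{(v',γ')}, and consequently Pr^σ_α(◇F_i) = Σ_{v∈F_i} y'_v for every i, where y'_v = Σ_{v'∈V∖F} Σ_{γ'∈Γ_{v'}} p_{(v',γ',v)} y'_{(v',γ')}. -/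
open scoped BigOperators
open MeasureTheory

namespace MDP

variable {V A : Type} [Fintype V] [Fintype A]

/-- Feasibility for the multi-objective LP associated with `(M, α, F)`:
`y` are the variables `y_{(v,γ)}` (for `v ∉ F`), `yF` the variables `y_v` (for `v ∈ F`). -/
def LPFeasible [DecidableEq V] (M : MDP V A) (α : V → ℝ) (F : Finset V)
    (y : V → A → ℝ) (yF : V → ℝ) : Prop :=
  (∀ v ∉ F, (∑ a ∈ M.enabled v, y v a) -
      (∑ v' ∈ Fᶜ, ∑ a' ∈ M.enabled v', M.p v' a' v * y v' a') = α v) ∧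
  (∀ v ∈ F, yF v - (∑ v' ∈ Fᶜ, ∑ a' ∈ M.enabled v', M.p v' a' v * y v' a') = 0) ∧
  (∀ v ∈ F, 0 ≤ yF v) ∧
  (∀ v ∉ F, ∀ a ∈ M.enabled v, 0 ≤ y v a)

/-- The substochastic matrix `P^σ` on `V ∖ F` induced by a memoryless strategy `σ`. -/
noncomputable def Pmat [DecidableEq V] (M : MDP V A) (σ : M.Strategy) (F : Finset V) :
    Matrix {v : V // v ∉ F} {v : V // v ∉ F} ℝ :=
  Matrix.of fun v v' => ∑ a ∈ M.enabled v.1, σ.act [] v.1 a * M.p v.1 a v'.1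

end MDP

namespace MDP

variable {V A : Type} [Fintype V] [Fintype A]

/-- The expected-visits vector: `y'_{(v,γ)} = ∑_{v' ∈ V∖F} α(v') ∑_{n=0}^∞
(P^σ)^n_{v',v} · σ(v)(γ)`, the expected number of visits to `v ∉ F` at which
action `γ` is chosen, under the memoryless strategy `σ` started from `α`. -/
noncomputable def yvisit [DecidableEq V] (M : MDP V A) (σ : M.Strategy) (F : Finset V)
    (α : V → ℝ) (v : V) (a : A) : ℝ :=
  if h : v ∈ F then 0
  else ∑ v' : {w : V // w ∉ F},
    α v'.1 * ∑' n : ℕ, (M.Pmat σ F ^ n) v' ⟨v, h⟩ * σ.act [] v a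

/-- The induced values `y'_v = ∑_{v' ∈ V∖F} ∑_{γ'} p_{(v',γ',v)} y'_{(v',γ')}`
for `v ∈ F`. -/
noncomputable def yvisitF [DecidableEq V] (M : MDP V A) (σ : M.Strategy) (F : Finset V)
    (α : V → ℝ) (v : V) : ℝ :=
  ∑ v' ∈ Fᶜ, ∑ a' ∈ M.enabled v', M.p v' a' v * M.yvisit σ F α v' a'

end MDP

namespace MDP

open ProbabilityTheory Measure

/-- The uniform probability measure on the unit interval. -/
noncomputable abbrev unitUniform : Measure ℝ := volume.restrict (Set.Icc (0 : ℝ) 1)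

instance : IsProbabilityMeasure unitUniform := ⟨by simp⟩

theorem unitUniform_eq_restrict_Ico : unitUniform = volume.restrict (Set.Ico (0 : ℝ) 1) :=
  (Measure.restrict_congr_set Ico_ae_eq_Icc).symm

/-- The law of a fair binary digit. -/
noncomputable def fairDigit : Measure (Fin 2) := (2⁻¹ : ENNReal) • Measure.count

theorem fairDigit_singleton (a : Fin 2) : fairDigit {a} = 2⁻¹ := by
  simp [fairDigit]

instance : IsProbabilityMeasure fairDigit :=
  ⟨by simp [fairDigit, Measure.count_apply, ENNReal.inv_mul_cancel]⟩

theorem measurable_digits : Measurable fun x : ℝ => Real.digits x 2 := by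
  refine measurable_pi_lambda _ fun m => ?_
  have h : Measurable fun x : ℝ => ⌊x * (2 : ℕ) ^ (m + 1)⌋₊ :=
    Nat.measurable_floor.comp (by fun_prop)
  exact (Measurable.of_discrete (f := fun n : ℕ => Fin.ofNat 2 n)).comp h

/-- Prescribing the first `N` binary digits cuts out a dyadic interval of length `2⁻ᴺ`. -/
theorem exists_dyadic_interval (b : ℕ → Fin 2) (N : ℕ) :
    ∃ j : ℕ, j + 1 ≤ 2 ^ N ∧ ∀ x ∈ Set.Ico (0 : ℝ) 1,
      (∀ m < N, Real.digits x 2 m = b m) ↔ ⌊x * 2 ^ N⌋₊ = j := by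
  induction N with
  | zero =>
    refine ⟨0, by simp, fun x hx => ?_⟩
    simpa using hx.2
  | succ N ih =>
    obtain ⟨j, hj, h⟩ := ih
    refine ⟨2 * j + (b N).val, ?_, fun x hx => ?_⟩
    · have := (b N).isLt
      rw [pow_succ]
      omega
    · have h2 : ⌊x * 2 ^ (N + 1)⌋₊ / 2 = ⌊x * 2 ^ N⌋₊ := by
        rw [← Nat.floor_div_natCast]
        congr 1
        push_cast
        ring
      have hd : Real.digits x 2 N = b N ↔ ⌊x * 2 ^ (N + 1)⌋₊ % 2 = (b N).val := by
        rw [Fin.ext_iff]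
        simp [Real.digits]
      rw [Nat.forall_lt_succ_right, h x hx, hd, ← h2]
      have := (b N).isLt
      omega

theorem unitUniform_digits_cylinder (b : ℕ → Fin 2) (N : ℕ) :
    unitUniform {x | ∀ m < N, Real.digits x 2 m = b m} = 2⁻¹ ^ N := by
  obtain ⟨j, hj, h⟩ := exists_dyadic_interval b N
  have hj' : (j : ℝ) + 1 ≤ 2 ^ N := by exact_mod_cast hj
  rw [unitUniform_eq_restrict_Ico, Measure.restrict_apply' measurableSet_Ico]
  have : {x : ℝ | ∀ m < N, Real.digits x 2 m = b m} ∩ Set.Ico 0 1 =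
      Set.Ico ((j : ℝ) / 2 ^ N) ((j + 1) / 2 ^ N) := by
    ext x
    have hp : (0 : ℝ) < 2 ^ N := by positivity
    simp only [Set.mem_inter_iff, Set.mem_ofPred_eq, Set.mem_Ico, div_le_iff₀ hp, lt_div_iff₀ hp]
    constructor
    · rintro ⟨h1, h2⟩
      rw [h x h2] at h1
      exact (Nat.floor_eq_iff (by have := h2.1; positivity)).1 h1
    · rintro ⟨h1, h2⟩
      have hx : x ∈ Set.Ico (0 : ℝ) 1 := by
        constructor
        · by_contra hx
          have : x * 2 ^ N < 0 := mul_neg_of_neg_of_pos (not_le.1 hx) hp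
          have : (0 : ℝ) ≤ j := by positivity
          linarith
        · by_contra hx
          have : 1 * 2 ^ N ≤ x * 2 ^ N := mul_le_mul_of_nonneg_right (not_lt.1 hx) hp.le
          linarith
      refine ⟨(h x hx).2 ?_, hx⟩
      exact (Nat.floor_eq_iff (by have := hx.1; positivity)).2 ⟨h1, h2⟩
  rw [this, Real.volume_Ico, ← sub_div, add_sub_cancel_left, one_div, ← inv_pow,
    ENNReal.ofReal_pow (by positivity), ENNReal.ofReal_inv_of_pos (by norm_num)]
  simp

theorem map_digits_eq_infinitePi :
    unitUniform.map (fun x => Real.digits x 2) = infinitePi fun _ : ℕ => fairDigit := by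
  have hrange (N : ℕ) : (unitUniform.map fun x => Real.digits x 2).map (Finset.range N).restrict =
      (infinitePi fun _ : ℕ => fairDigit).map (Finset.range N).restrict := by
    rw [infinitePi_map_restrict]
    refine Measure.ext_of_singleton fun b => ?_
    rw [Measure.pi_singleton, Measure.map_map (by fun_prop) measurable_digits,
      Measure.map_apply ((by fun_prop : Measurable (Finset.range N).restrict).comp
        measurable_digits) (measurableSet_singleton _)]
    simp only [fairDigit_singleton, Finset.prod_const, Finset.card_univ, Fintype.card_coe,
      Finset.card_range]
    rw [← unitUniform_digits_cylinder
      (fun m => if h : m ∈ Finset.range N then b ⟨m, h⟩ else 0) N]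
    congr 1
    ext x
    simp only [Set.mem_preimage, Set.mem_singleton_iff, Set.mem_ofPred_eq, funext_iff,
      Function.comp, Finset.restrict, Subtype.forall, Finset.mem_range]
    refine forall₂_congr fun m hm => ?_
    simp [hm]
  refine (isProjectiveLimit_infinitePi _).unique (fun I => ?_) |>.symm
  obtain ⟨N, hN⟩ := I.exists_nat_subset_range
  refine Eq.trans ?_ (infinitePi_map_restrict fun _ : ℕ => fairDigit)
  rw [← Finset.restrict₂_comp_restrict hN,
    ← Measure.map_map (by fun_prop) (by fun_prop), hrange,
    Measure.map_map (by fun_prop) (by fun_prop)]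

theorem measurable_ofDigits : Measurable (Real.ofDigits (b := 2)) :=
  Real.continuous_ofDigits.measurable

theorem infinitePi_fairDigit_map_ofDigits :
    (infinitePi fun _ : ℕ => fairDigit).map Real.ofDigits = unitUniform := by
  rw [← map_digits_eq_infinitePi, Measure.map_map measurable_ofDigits measurable_digits]
  refine (Measure.map_congr ?_).trans Measure.map_id
  rw [unitUniform_eq_restrict_Ico]
  filter_upwards [ae_restrict_mem measurableSet_Ico] with x hx
  exact Real.ofDigits_digits (by norm_num) hx

/-- A version of `unif` that is measurable on the whole line. -/
noncomputable def unifDigits (k : ℕ) (x : ℝ) : ℝ :=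
  Real.ofDigits fun n => Real.digits x 2 (Nat.pair k n)

theorem measurable_unifDigits (k : ℕ) : Measurable (unifDigits k) :=
  measurable_ofDigits.comp <| measurable_pi_lambda _ fun n =>
    (measurable_pi_apply (Nat.pair k n)).comp measurable_digits

theorem unif_eq_unifDigits (k : ℕ) {x : ℝ} (hx : 0 ≤ x) : unif k x = unifDigits k x := by
  refine tsum_congr fun n => ?_
  have hb (m : ℕ) : bit m x = (Real.digits x 2 m : ℕ) := by
    have h : ⌊x * 2 ^ (m + 1)⌋ = (⌊x * 2 ^ (m + 1)⌋₊ : ℤ) :=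
      (Int.natCast_floor_eq_floor (by positivity)).symm
    have h2 := Nat.mod_two_eq_zero_or_one ⌊x * 2 ^ (m + 1)⌋₊
    simp only [bit, h, Real.digits, Fin.val_ofNat, Nat.cast_ofNat]
    rcases h2 with h2 | h2
    · rw [if_neg (by omega), h2]; simp
    · rw [if_pos (by omega), h2]; simp
  simp [hb, Real.ofDigitsTerm, div_eq_mul_inv]

theorem map_unifDigits_eq_infinitePi :
    unitUniform.map (fun x k => unifDigits k x) = infinitePi fun _ : ℕ => unitUniform := by
  have h1 := map_infinitePi_infinitePi_of_inj (P := fun _ : ℕ => fairDigit)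
    (f := fun p : ℕ × ℕ => Nat.pair p.1 p.2) Nat.pairEquiv.injective
  have h2 := infinitePi_map_curry (fun _ _ : ℕ => fairDigit)
  have h3 := infinitePi_map_pi (fun _ : ℕ => infinitePi fun _ : ℕ => fairDigit)
    (f := fun _ => Real.ofDigits) (fun _ => measurable_ofDigits)
  simp only [infinitePi_fairDigit_map_ofDigits] at h3
  have hm : Measurable fun (ω : ℕ → ℕ → Fin 2) k => Real.ofDigits (ω k) :=
    measurable_pi_lambda _ fun k => measurable_ofDigits.comp (measurable_pi_apply k)
  rw [← h3, ← h2, ← h1, ← map_digits_eq_infinitePi,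
    Measure.map_map (by fun_prop) measurable_digits,
    Measure.map_map (by fun_prop) ((by fun_prop : Measurable _).comp measurable_digits),
    Measure.map_map hm ((MeasurableEquiv.measurable _).comp
      ((by fun_prop : Measurable _).comp measurable_digits))]
  rfl

theorem map_unifDigits (k : ℕ) : unitUniform.map (unifDigits k) = unitUniform := by
  have h := congrArg (Measure.map fun ω => ω k) map_unifDigits_eq_infinitePi
  rwa [infinitePi_map_eval, Measure.map_map (measurable_pi_apply k)
    (measurable_pi_lambda _ measurable_unifDigits)] at h

theorem iIndepFun_unifDigits : iIndepFun unifDigits unitUniform := by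
  rw [iIndepFun_iff_map_fun_eq_infinitePi_map measurable_unifDigits]
  simp only [map_unifDigits]
  exact map_unifDigits_eq_infinitePi

theorem measurable_sample {S : Type} [Fintype S] [Nonempty S] [MeasurableSpace S] (q : S → ℝ) :
    Measurable (sample q) := by
  classical
  let e := Fintype.equivFin S
  let Q : Fin (Fintype.card S) → ℝ := fun i => ∑ j ∈ Finset.Iic i, q (e.symm j)
  let G : (Fin (Fintype.card S) → Bool) → S := fun b =>
    if h : (Finset.univ.filter fun i => b i = true).Nonempty then
      e.symm ((Finset.univ.filter fun i => b i = true).min' h)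
    else Classical.arbitrary S
  have hG : sample q = G ∘ fun u i => decide (u < Q i) := by
    funext u
    simp [sample, G, Q, e]
  rw [hG]
  refine (Measurable.of_discrete (f := G)).comp (measurable_pi_lambda _ fun i => ?_)
  refine measurable_to_bool ?_
  convert measurableSet_Iio (a := Q i) using 1
  ext u
  simp

/-- Inverse-CDF sampling from a uniform seed has the prescribed distribution. -/
theorem unitUniform_sample_eq {S : Type} [Fintype S] [Nonempty S] {q : S → ℝ}
    (h0 : ∀ s, 0 ≤ q s) (h1 : ∑ s, q s = 1) (s : S) :
    unitUniform.real {u | sample q u = s} = q s := by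
  classical
  set e := Fintype.equivFin S with he
  set i := e s with hi
  have hs : e.symm i = s := by simp [hi]
  have hR0 : 0 ≤ ∑ j ∈ Finset.Iio i, q (e.symm j) := Finset.sum_nonneg fun j _ => h0 _
  have htot : ∑ j, q (e.symm j) = 1 := by rw [← h1]; exact e.symm.sum_comp q
  have hQ1 : ∑ j ∈ Finset.Iic i, q (e.symm j) ≤ 1 := by
    rw [← htot]
    exact Finset.sum_le_sum_of_subset_of_nonneg (Finset.subset_univ _) fun _ _ _ => h0 _
  have hQR : ∑ j ∈ Finset.Iic i, q (e.symm j) = ∑ j ∈ Finset.Iio i, q (e.symm j) + q s := by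
    rw [← Finset.Iio_insert, Finset.sum_insert (by simp), hs, add_comm]
  have hset : {u | sample q u = s} ∩ Set.Ico (0 : ℝ) 1 =
      Set.Ico (∑ j ∈ Finset.Iio i, q (e.symm j)) (∑ j ∈ Finset.Iic i, q (e.symm j)) := by
    ext u
    have key (hu : u ∈ Set.Ico (0 : ℝ) 1) : sample q u = s ↔
        u < ∑ j ∈ Finset.Iic i, q (e.symm j) ∧
          ∀ k < i, ∑ j ∈ Finset.Iic k, q (e.symm j) ≤ u := by
      have hne : (Finset.univ.filter fun i => u < ∑ j ∈ Finset.Iic i, q (e.symm j)).Nonempty := by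
        have hc : 0 < Fintype.card S := Fintype.card_pos
        refine ⟨⟨Fintype.card S - 1, by omega⟩, ?_⟩
        have : Finset.Iic (⟨Fintype.card S - 1, by omega⟩ : Fin (Fintype.card S)) =
            Finset.univ := by
          ext j
          simp only [Finset.mem_Iic, Fin.le_def, Finset.mem_univ, iff_true]
          omega
        simp only [Finset.mem_filter, Finset.mem_univ, true_and]
        rw [this, htot]
        exact hu.2
      simp only [sample, ← he]
      rw [dif_pos hne, Equiv.symm_apply_eq, ← hi]
      constructor
      · intro h
        have hm := Finset.min'_mem _ hne
        rw [h] at hm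
        refine ⟨by simpa using hm, fun k hk => ?_⟩
        by_contra hku
        have := Finset.min'_le _ k (by simpa using hku :
          k ∈ Finset.univ.filter fun i => u < ∑ j ∈ Finset.Iic i, q (e.symm j))
        rw [h] at this
        exact absurd hk (not_lt.2 this)
      · rintro ⟨ha, hb⟩
        refine le_antisymm (Finset.min'_le _ _ (by simpa using ha)) ?_
        refine Finset.le_min' _ _ _ fun k hk => ?_
        by_contra hki
        exact absurd (hb k (not_le.1 hki)) (not_le.2 (by simpa using hk))
    constructor
    · rintro ⟨hsu, hu⟩
      obtain ⟨ha, hb⟩ := (key hu).1 hsu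
      refine ⟨?_, ha⟩
      rcases (Finset.Iio i).eq_empty_or_nonempty with hempty | hne
      · rw [hempty]
        simpa using hu.1
      · have hmax := Finset.max'_mem _ hne
        have : Finset.Iio i = Finset.Iic ((Finset.Iio i).max' hne) := by
          ext k
          rw [Finset.mem_Iic]
          exact ⟨fun hk => Finset.le_max' _ _ hk,
            fun hk => Finset.mem_Iio.2 (hk.trans_lt (Finset.mem_Iio.1 hmax))⟩
        rw [this]
        exact hb _ (Finset.mem_Iio.1 hmax)
    · rintro ⟨ha, hb⟩
      have hu : u ∈ Set.Ico (0 : ℝ) 1 := ⟨hR0.trans ha, hb.trans_le hQ1⟩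
      refine ⟨(key hu).2 ⟨hb, fun k hk => le_trans ?_ ha⟩, hu⟩
      refine Finset.sum_le_sum_of_subset_of_nonneg (fun l hl => ?_) fun _ _ _ => h0 _
      exact Finset.mem_Iio.2 ((Finset.mem_Iic.1 hl).trans_lt hk)
  rw [unitUniform_eq_restrict_Ico, Measure.real, Measure.restrict_apply' measurableSet_Ico, hset,
    Real.volume_Ico, hQR, add_sub_cancel_left, ENNReal.toReal_ofReal (h0 s)]

/-- The Markov chain of (state, action) pairs driven by a sequence of uniform samples, for the
memoryless strategy that plays as `σ` does with empty history. -/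
noncomputable def chain {V A : Type} [Fintype V] [Fintype A] [Nonempty V] [Nonempty A]
    (M : MDP V A) (σ : M.Strategy) (α : V → ℝ) (u : ℕ → ℝ) : ℕ → V × A
  | 0 => (sample α (u 0), sample (σ.act [] (sample α (u 0))) (u 1))
  | n + 1 =>
      let r := chain M σ α u n
      let s' := sample (M.p r.1 r.2) (u (2 * n + 2))
      (s', sample (σ.act [] s') (u (2 * n + 3)))

section Chain

variable {V A : Type} [Fintype V] [Fintype A] [Nonempty V] [Nonempty A]
  (M : MDP V A) (σ : M.Strategy) (α : V → ℝ)

theorem run_snd_eq_chain (hσ : σ.Memoryless) (x : ℝ) (n : ℕ) :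
    (M.run σ α x n).2 = M.chain σ α (fun k => unif k x) n := by
  induction n with
  | zero => rfl
  | succ n ih =>
    simp only [run, chain, ← ih]
    rw [hσ _ []]

theorem chain_congr {u u' : ℕ → ℝ} (n : ℕ) (h : ∀ i < 2 * n + 2, u i = u' i) :
    M.chain σ α u n = M.chain σ α u' n := by
  induction n with
  | zero => simp only [chain]; rw [h 0 (by omega), h 1 (by omega)]
  | succ n ih =>
    simp only [chain]
    rw [ih fun i hi => h i (by omega), h (2 * n + 2) (by omega), h (2 * n + 3) (by omega)]

variable [MeasurableSpace V] [MeasurableSingletonClass V]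
  [MeasurableSpace A] [MeasurableSingletonClass A]

theorem measurable_chain (n : ℕ) : Measurable fun u => M.chain σ α u n := by
  have hact (i : ℕ) {f : (ℕ → ℝ) → V} (hf : Measurable f) :
      Measurable fun u => sample (σ.act [] (f u)) (u i) :=
    (measurable_from_prod_countable_right (f := fun z : V × ℝ => sample (σ.act [] z.1) z.2)
      fun v => measurable_sample (σ.act [] v)).comp (hf.prodMk (measurable_pi_apply i))
  induction n with
  | zero =>
    have h0 : Measurable fun u : ℕ → ℝ => sample α (u 0) :=
      (measurable_sample α).comp (measurable_pi_apply 0)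
    exact h0.prodMk (hact 1 h0)
  | succ n ih =>
    have hs : Measurable fun u : ℕ → ℝ =>
        sample (M.p (M.chain σ α u n).1 (M.chain σ α u n).2) (u (2 * n + 2)) :=
      (measurable_from_prod_countable_right
        (f := fun z : (V × A) × ℝ => sample (M.p z.1.1 z.1.2) z.2)
        fun r => measurable_sample (M.p r.1 r.2)).comp (ih.prodMk (measurable_pi_apply _))
    exact hs.prodMk (hact _ hs)

/-- The chain driven by the digit blocks of a single uniform seed. -/
noncomputable def seedChain (n : ℕ) (x : ℝ) : V × A :=
  M.chain σ α (fun k => unifDigits k x) n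

theorem measurable_seedChain (n : ℕ) : Measurable (M.seedChain σ α n) :=
  (M.measurable_chain σ α n).comp (measurable_pi_lambda _ measurable_unifDigits)

omit [MeasurableSpace V] [MeasurableSingletonClass V]
  [MeasurableSpace A] [MeasurableSingletonClass A] in
theorem stateAt_eq_seedChain (hσ : σ.Memoryless) {x : ℝ} (hx : 0 ≤ x) (n : ℕ) :
    M.stateAt σ α x n = (M.seedChain σ α n x).1 := by
  rw [stateAt, M.run_snd_eq_chain σ α hσ, seedChain]
  simp only [unif_eq_unifDigits _ hx]

end Chain

theorem sum_measureReal_inter_fiber {Ω S : Type*} [MeasurableSpace Ω] (μ : Measure Ω)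
    [IsFiniteMeasure μ] [Fintype S] [MeasurableSpace S] [MeasurableSingletonClass S]
    {g : Ω → S} (hg : Measurable g) (E : Set Ω) :
    ∑ s, μ.real {x | x ∈ E ∧ g x = s} = μ.real E := by
  have h (s : S) : μ.real {x | x ∈ E ∧ g x = s} = (μ.restrict E).real (g ⁻¹' {s}) := by
    rw [measureReal_restrict_apply (hg (measurableSet_singleton s)), Set.inter_comm]
    rfl
  simp only [h]
  rw [sum_measureReal_preimage_singleton _ fun s _ => hg (measurableSet_singleton s)]
  simp

section Law

variable {V A : Type} [Fintype V] [Fintype A] [Nonempty V] [Nonempty A]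
  [MeasurableSpace V] [MeasurableSingletonClass V]
  [MeasurableSpace A] [MeasurableSingletonClass A]
  (M : MDP V A) (σ : M.Strategy) (α : V → ℝ)

omit [Nonempty A] [Fintype A] [MeasurableSpace A] [MeasurableSingletonClass A] in
theorem unitUniform_sample_unifDigits (q : V → ℝ) (i : ℕ) (v : V) :
    unitUniform.real {x | sample q (unifDigits i x) = v} = unitUniform.real {u | sample q u = v} := by
  have hq : MeasurableSet {u | sample q u = v} :=
    measurable_sample q (measurableSet_singleton v)
  conv_rhs => rw [← map_unifDigits i, map_measureReal_apply (measurable_unifDigits i) hq]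
  rfl

theorem unitUniform_sample_pair (q : V → ℝ) (q' : A → ℝ) {i j : ℕ} (hij : i ≠ j) (v : V) (a : A) :
    unitUniform.real {x | sample q (unifDigits i x) = v ∧ sample q' (unifDigits j x) = a} =
      unitUniform.real {u | sample q u = v} * unitUniform.real {u | sample q' u = a} := by
  have hq : MeasurableSet {u | sample q u = v} :=
    measurable_sample q (measurableSet_singleton v)
  have hq' : MeasurableSet {u | sample q' u = a} :=
    measurable_sample q' (measurableSet_singleton a)
  have h := (iIndepFun_unifDigits.indepFun hij).measure_inter_preimage_eq_mul _ _ hq hq'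
  rw [← unitUniform_sample_unifDigits q i, ← unitUniform_sample_unifDigits q' j, Measure.real,
    Measure.real, Measure.real, ← ENNReal.toReal_mul]
  exact congrArg _ h

theorem seedChain_zero (hα : IsDist α) (v : V) (a : A) :
    unitUniform.real {x | M.seedChain σ α 0 x = (v, a)} = α v * σ.act [] v a := by
  have h : {x | M.seedChain σ α 0 x = (v, a)} = {x | sample α (unifDigits 0 x) = v ∧
      sample (σ.act [] v) (unifDigits 1 x) = a} := by
    ext x
    simp only [seedChain, chain, Set.mem_ofPred_eq, Prod.mk.injEq]
    exact and_congr_right fun h => by rw [h]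
  rw [h, unitUniform_sample_pair _ _ (by norm_num), unitUniform_sample_eq hα.1 hα.2,
    unitUniform_sample_eq (σ.act_nonneg _ _) (σ.act_sum _ _)]

theorem seedChain_succ (n : ℕ) (r : V × A) (v : V) (a : A) :
    unitUniform.real {x | M.seedChain σ α (n + 1) x = (v, a) ∧ M.seedChain σ α n x = r} =
      unitUniform.real {x | M.seedChain σ α n x = r} *
        unitUniform.real {u | sample (M.p r.1 r.2) u = v} * σ.act [] v a := by
  classical
  let S := Finset.range (2 * n + 2)
  let T : Finset ℕ := {2 * n + 2, 2 * n + 3}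
  have hST : Disjoint S T := by
    rw [Finset.disjoint_left]
    intro i hi hi'
    simp only [S, T, Finset.mem_range, Finset.mem_insert, Finset.mem_singleton] at hi hi'
    omega
  have hind := iIndepFun_unifDigits.indepFun_finset S T hST measurable_unifDigits
  let extend : (S → ℝ) → ℕ → ℝ := fun w i => if h : i ∈ S then w ⟨i, h⟩ else 0
  have hext : Measurable extend := by
    refine measurable_pi_lambda _ fun i => ?_
    by_cases h : i ∈ S
    · simpa only [extend, dif_pos h] using measurable_pi_apply _
    · simpa only [extend, dif_neg h] using measurable_const
  have hA : MeasurableSet {w : S → ℝ | M.chain σ α (extend w) n = r} :=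
    ((M.measurable_chain σ α n).comp hext) (measurableSet_singleton r)
  have m1 : 2 * n + 2 ∈ T := by simp [T]
  have m2 : 2 * n + 3 ∈ T := by simp [T]
  have hB : MeasurableSet {w : T → ℝ | sample (M.p r.1 r.2) (w ⟨_, m1⟩) = v ∧
      sample (σ.act [] v) (w ⟨_, m2⟩) = a} :=
    ((measurable_sample (M.p r.1 r.2)).comp (measurable_pi_apply _)
      (measurableSet_singleton v)).inter
    ((measurable_sample (σ.act [] v)).comp (measurable_pi_apply _) (measurableSet_singleton a))
  have h := hind.measure_inter_preimage_eq_mul _ _ hA hB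
  have hchain (x : ℝ) : M.chain σ α (extend fun i : S => unifDigits i x) n = M.seedChain σ α n x :=
    M.chain_congr σ α n fun i hi => by simp [extend, S, hi]
  have hset : {x | M.seedChain σ α (n + 1) x = (v, a) ∧ M.seedChain σ α n x = r} =
      {x | M.seedChain σ α n x = r} ∩
        {x | sample (M.p r.1 r.2) (unifDigits (2 * n + 2) x) = v ∧
          sample (σ.act [] v) (unifDigits (2 * n + 3) x) = a} := by
    ext x
    simp only [Set.mem_ofPred_eq, Set.mem_inter_iff]
    rw [and_comm]
    refine and_congr_right fun hr => ?_
    have hr' : M.chain σ α (fun k => unifDigits k x) n = r := hr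
    simp only [seedChain, chain, hr', Prod.mk.injEq]
    exact and_congr_right fun h => by rw [h]
  rw [mul_assoc, ← unitUniform_sample_eq (σ.act_nonneg [] v) (σ.act_sum [] v) a,
    ← unitUniform_sample_pair (i := 2 * n + 2) (j := 2 * n + 3) _ _ (by omega), hset,
    Measure.real, Measure.real, Measure.real, ← ENNReal.toReal_mul]
  simp only [Set.preimage_ofPred_eq, hchain] at h
  exact congrArg _ h

/-- The distribution of the state at time `n`. -/
noncomputable def stateProb (n : ℕ) (v : V) : ℝ :=
  unitUniform.real {x | (M.seedChain σ α n x).1 = v}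

/-- The transition probabilities of the state chain induced by a memoryless strategy. -/
noncomputable def transProb {V A : Type} [Fintype V] [Fintype A] (M : MDP V A) (σ : M.Strategy)
    (v v' : V) : ℝ :=
  ∑ a ∈ M.enabled v, σ.act [] v a * M.p v a v'

theorem sum_seedChain_eq_stateProb (n : ℕ) (v : V) :
    ∑ a, unitUniform.real {x | M.seedChain σ α n x = (v, a)} = M.stateProb σ α n v := by
  rw [stateProb, ← sum_measureReal_inter_fiber _ (measurable_snd.comp (M.measurable_seedChain σ α n))]
  simp only [Prod.ext_iff]
  rfl

theorem stateProb_zero (hα : IsDist α) (v : V) : M.stateProb σ α 0 v = α v := by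
  rw [← sum_seedChain_eq_stateProb]
  simp only [M.seedChain_zero σ α hα, ← Finset.mul_sum, σ.act_sum, mul_one]

/-- Conditionally on the current state, the action is chosen according to the strategy. -/
theorem seedChain_eq_mul (hα : IsDist α) (n : ℕ) (v : V) (a : A) :
    unitUniform.real {x | M.seedChain σ α n x = (v, a)} =
      M.stateProb σ α n v * σ.act [] v a := by
  cases n with
  | zero => rw [M.seedChain_zero σ α hα, M.stateProb_zero σ α hα]
  | succ n =>
    have h (b : A) : unitUniform.real {x | M.seedChain σ α (n + 1) x = (v, b)} =
        (∑ r : V × A, unitUniform.real {x | M.seedChain σ α n x = r} *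
          unitUniform.real {u | sample (M.p r.1 r.2) u = v}) * σ.act [] v b := by
      rw [← sum_measureReal_inter_fiber _ (M.measurable_seedChain σ α n), Finset.sum_mul]
      exact Finset.sum_congr rfl fun r _ => M.seedChain_succ σ α n r v b
    rw [← sum_seedChain_eq_stateProb]
    simp only [h, ← Finset.mul_sum, σ.act_sum, mul_one]

/-- The joint law of two consecutive states. -/
theorem stateProb_step (hα : IsDist α) (n : ℕ) (v v' : V) :
    unitUniform.real {x | (M.seedChain σ α n x).1 = v ∧ (M.seedChain σ α (n + 1) x).1 = v'} =
      M.stateProb σ α n v * M.transProb σ v v' := by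
  have h (a : A) : unitUniform.real {x | M.seedChain σ α n x = (v, a) ∧
      (M.seedChain σ α (n + 1) x).1 = v'} = M.stateProb σ α n v * (σ.act [] v a *
        unitUniform.real {u | sample (M.p v a) u = v'}) := by
    rw [← sum_measureReal_inter_fiber _ (measurable_snd.comp (M.measurable_seedChain σ α (n + 1)))]
    have hb (b : A) := M.seedChain_succ σ α n (v, a) v' b
    rw [M.seedChain_eq_mul σ α hα] at hb
    rw [← mul_assoc, ← mul_one (_ * _ * _), ← σ.act_sum [] v', Finset.mul_sum]
    refine Finset.sum_congr rfl fun b _ => ?_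
    rw [← hb]
    congr 1
    ext x
    simp only [Set.mem_ofPred_eq, Prod.ext_iff (x := M.seedChain σ α (n + 1) x), Function.comp]
    tauto
  have ht : M.transProb σ v v' = ∑ a, σ.act [] v a * M.p v a v' :=
    Finset.sum_subset (Finset.subset_univ _) fun a _ ha => by simp [σ.act_support [] v a ha]
  rw [← sum_measureReal_inter_fiber _ (measurable_snd.comp (M.measurable_seedChain σ α n)),
    ht, Finset.mul_sum]
  · refine Finset.sum_congr rfl fun a _ => ?_
    have : {x | x ∈ {x | (M.seedChain σ α n x).1 = v ∧ (M.seedChain σ α (n + 1) x).1 = v'} ∧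
        (Prod.snd ∘ M.seedChain σ α n) x = a} =
        {x | M.seedChain σ α n x = (v, a) ∧ (M.seedChain σ α (n + 1) x).1 = v'} := by
      ext x
      simp only [Set.mem_ofPred_eq, Prod.ext_iff (x := M.seedChain σ α n x), Function.comp]
      tauto
    rw [this, h]
    by_cases ha : a ∈ M.enabled v
    · rw [unitUniform_sample_eq (M.p_nonneg v a) (M.p_sum v a ha)]
    · simp [σ.act_support [] v a ha]

theorem stateProb_succ (hα : IsDist α) (n : ℕ) (v : V) :
    M.stateProb σ α (n + 1) v = ∑ w, M.stateProb σ α n w * M.transProb σ w v := by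
  rw [stateProb, ← sum_measureReal_inter_fiber _
    (measurable_fst.comp (M.measurable_seedChain σ α n))]
  refine Finset.sum_congr rfl fun w _ => ?_
  rw [← M.stateProb_step σ α hα]
  congr 1
  ext x
  exact and_comm

end Law

theorem _root_.Matrix.summable_pow_of_rowSum_lt_one {ι : Type*} [Fintype ι] [DecidableEq ι]
    (P : Matrix ι ι ℝ) (h0 : ∀ n u v, 0 ≤ (P ^ n) u v) (h1 : ∀ n u, ∑ v, (P ^ n) u v ≤ 1)
    {N : ℕ} (hN : ∀ u, ∑ v, (P ^ N) u v < 1) (u v : ι) :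
    Summable fun n => (P ^ n) u v := by
  have : Nonempty ι := ⟨u⟩
  obtain ⟨u₀, hu₀⟩ := Finite.exists_max fun u => ∑ v, (P ^ N) u v
  set c := ∑ v, (P ^ N) u₀ v with hc
  have hc1 : 0 < 1 - c := sub_pos.2 (hN u₀)
  let f : ℕ → ℝ := fun n => ∑ v, (P ^ n) u v
  have hf0 (n : ℕ) : 0 ≤ f n := Finset.sum_nonneg fun v _ => h0 n u v
  have hstep (m : ℕ) : f (N + m) ≤ c * f m := by
    simp only [f, add_comm N m, pow_add, Matrix.mul_apply]
    rw [Finset.sum_comm, Finset.mul_sum]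
    refine Finset.sum_le_sum fun w _ => ?_
    rw [← Finset.mul_sum, mul_comm]
    exact mul_le_mul_of_nonneg_right (hu₀ w) (h0 m u w)
  have hf : Summable f := by
    refine summable_of_sum_range_le (c := N / (1 - c)) hf0 fun n => ?_
    rw [le_div_iff₀ hc1]
    have e1 : ∑ m ∈ Finset.range n, f m ≤ ∑ m ∈ Finset.range (N + n), f m :=
      Finset.sum_le_sum_of_subset_of_nonneg (Finset.range_mono (by omega)) fun m _ _ => hf0 m
    have e2 : ∑ m ∈ Finset.range N, f m ≤ N := by
      simpa using Finset.sum_le_sum fun m (_ : m ∈ Finset.range N) => h1 m u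
    have e3 : ∑ m ∈ Finset.range n, f (N + m) ≤ c * ∑ m ∈ Finset.range n, f m := by
      rw [Finset.mul_sum]
      exact Finset.sum_le_sum fun m _ => hstep m
    rw [Finset.sum_range_add] at e1
    linarith
  exact Summable.of_nonneg_of_le (fun n => h0 n u v)
    (fun n => Finset.single_le_sum (f := fun v => (P ^ n) u v) (fun w _ => h0 n u w)
      (Finset.mem_univ v)) hf

section Reach

variable {V A : Type} [Fintype V] [Fintype A]

theorem Absorbing.transProb_eq_zero {M : MDP V A} (σ : M.Strategy) {v v' : V}
    (h : M.Absorbing v) (hv : v' ≠ v) : M.transProb σ v v' = 0 := by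
  classical
  obtain ⟨a, ha, hp⟩ := h
  have hs := M.p_sum v a (by simp [ha])
  rw [← Finset.add_sum_erase _ _ (Finset.mem_univ v), hp] at hs
  have h0 : ∑ x ∈ Finset.univ.erase v, M.p v a x = 0 := by linarith
  rw [Finset.sum_eq_zero_iff_of_nonneg fun x _ => M.p_nonneg v a x] at h0
  simp [transProb, ha, h0 v' (by simpa using hv)]

theorem Absorbing.transProb_self {M : MDP V A} (σ : M.Strategy) {v : V}
    (h : M.Absorbing v) : M.transProb σ v v = 1 := by
  obtain ⟨a, ha, hp⟩ := h
  have hs := σ.act_sum [] v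
  rw [← Finset.sum_subset (Finset.subset_univ (M.enabled v))
    fun b _ hb => σ.act_support [] v b hb, ha, Finset.sum_singleton] at hs
  simp [transProb, ha, hp, hs]

theorem transProb_nonneg (M : MDP V A) (σ : M.Strategy) (v v' : V) : 0 ≤ M.transProb σ v v' :=
  Finset.sum_nonneg fun _ _ => mul_nonneg (σ.act_nonneg _ _ _) (M.p_nonneg _ _ _)

theorem Pmat_pow_nonneg [DecidableEq V] (M : MDP V A) (σ : M.Strategy) (F : Finset V) (n : ℕ)
    (u v : {w : V // w ∉ F}) : 0 ≤ (M.Pmat σ F ^ n) u v := by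
  induction n generalizing v with
  | zero =>
    rw [pow_zero, Matrix.one_apply]
    split_ifs <;> norm_num
  | succ n ih =>
    rw [pow_succ, Matrix.mul_apply]
    exact Finset.sum_nonneg fun w _ => mul_nonneg (ih w) (M.transProb_nonneg σ w v)

theorem isDist_diracD_s6 [DecidableEq V] (u : V) : IsDist (diracD u) :=
  ⟨fun v => by unfold diracD; split_ifs <;> norm_num, by simp [diracD]⟩

variable [Nonempty V] [Nonempty A]
  [MeasurableSpace V] [MeasurableSingletonClass V]
  [MeasurableSpace A] [MeasurableSingletonClass A]
  (M : MDP V A) (σ : M.Strategy) (α : V → ℝ)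

theorem sum_stateProb (n : ℕ) : ∑ v, M.stateProb σ α n v = 1 := by
  have h := sum_measureReal_inter_fiber unitUniform
    (measurable_fst.comp (M.measurable_seedChain σ α n)) Set.univ
  simpa [stateProb] using h

theorem sum_stateProb_eq_measureReal (S : Finset V) (n : ℕ) :
    ∑ v ∈ S, M.stateProb σ α n v = unitUniform.real {x | (M.seedChain σ α n x).1 ∈ S} :=
  sum_measureReal_preimage_singleton S fun v _ =>
    (measurable_fst.comp (M.measurable_seedChain σ α n)) (measurableSet_singleton v)

theorem ae_mem_of_absorbing (hα : IsDist α) {S : Finset V} (hS : ∀ v ∈ S, M.Absorbing v) :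
    ∀ᵐ x ∂unitUniform, ∀ n, (M.seedChain σ α n x).1 ∈ S → (M.seedChain σ α (n + 1) x).1 ∈ S := by
  have h : ∀ᵐ x ∂unitUniform, ∀ n, ∀ v v' : V, v ∈ S → v' ≠ v →
      ¬ ((M.seedChain σ α n x).1 = v ∧ (M.seedChain σ α (n + 1) x).1 = v') := by
    simp only [ae_all_iff]
    intro n v v' hv hne
    have := M.stateProb_step σ α hα n v v'
    rw [(hS v hv).transProb_eq_zero σ hne, mul_zero, measureReal_eq_zero_iff] at this
    simpa only [ae_iff, not_not] using this
  filter_upwards [h] with x hx n hn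
  by_contra hn'
  exact hx n _ _ hn (fun he => hn' (by rwa [he])) ⟨rfl, rfl⟩

/-- The probability of reaching a set of absorbing states is the limit of the probabilities of
being in it. -/
theorem tendsto_sum_stateProb (hσ : σ.Memoryless) (hα : IsDist α) {S : Finset V}
    (hS : ∀ v ∈ S, M.Absorbing v) :
    Filter.Tendsto (fun n => ∑ v ∈ S, M.stateProb σ α n v) Filter.atTop
      (nhds (M.PrReach σ α (S : Set V))) := by
  let E : ℕ → Set ℝ := fun n => {x | (M.seedChain σ α n x).1 ∈ S}
  have hreach : M.PrReach σ α (S : Set V) = unitUniform.real (⋃ n, E n) := by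
    rw [PrReach, PrEvent, Measure.real, Measure.restrict_apply' measurableSet_Icc]
    congr 2
    ext x
    simp only [Set.mem_ofPred_eq, Set.mem_inter_iff, Set.mem_iUnion, E, and_comm (b := x ∈ _),
      Finset.mem_coe]
    exact and_congr_right fun hx => exists_congr fun n => by
      rw [M.stateAt_eq_seedChain σ α hσ hx.1]
  rw [hreach]
  have hacc := tendsto_measure_iUnion_accumulate (μ := unitUniform) (f := E)
  have hmeas (n : ℕ) : unitUniform (Set.accumulate E n) = unitUniform (E n) := by
    refine measure_congr ?_
    filter_upwards [M.ae_mem_of_absorbing σ α hα hS] with x hx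
    refine propext ⟨fun h => ?_, fun h => Set.subset_accumulate h⟩
    obtain ⟨m, hm, hxm⟩ := Set.mem_accumulate.1 h
    induction n, hm using Nat.le_induction with
    | base => exact hxm
    | succ k hk ih => exact hx k (ih (Set.mem_accumulate.2 ⟨m, hk, hxm⟩))
  simp only [hmeas] at hacc
  simp only [sum_stateProb_eq_measureReal]
  exact (ENNReal.tendsto_toReal (measure_ne_top _ _)).comp hacc

variable [DecidableEq V] {F : Finset V}

theorem stateProb_eq_Pmat_pow (habs : ∀ v ∈ F, M.Absorbing v) (hα : IsDist α)
    (n : ℕ) (v : {w : V // w ∉ F}) :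
    M.stateProb σ α n v = ∑ u : {w : V // w ∉ F}, α u * (M.Pmat σ F ^ n) u v := by
  induction n generalizing v with
  | zero => simp [M.stateProb_zero σ α hα, Matrix.one_apply]
  | succ n ih =>
    rw [M.stateProb_succ σ α hα, ← Finset.sum_subset (Finset.subset_univ Fᶜ),
      Finset.sum_subtype _ (p := fun w => w ∉ F) fun w => Finset.mem_compl]
    · simp only [ih, pow_succ, Matrix.mul_apply, Finset.mul_sum, Finset.sum_mul]
      rw [Finset.sum_comm]
      refine Finset.sum_congr rfl fun u _ => Finset.sum_congr rfl fun w _ => ?_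
      rw [mul_assoc]
      rfl
    · intro w _ hw
      rw [Finset.mem_compl, not_not] at hw
      rw [(habs w hw).transProb_eq_zero σ (fun h : v.1 = w => v.2 (h.symm ▸ hw)), mul_zero]

theorem sum_Pmat_pow (habs : ∀ v ∈ F, M.Absorbing v) (n : ℕ) (u : {w : V // w ∉ F}) :
    ∑ v, (M.Pmat σ F ^ n) u v = 1 - ∑ v ∈ F, M.stateProb σ (diracD u.1) n v := by
  have h (v : {w : V // w ∉ F}) : (M.Pmat σ F ^ n) u v = M.stateProb σ (diracD u.1) n v := by
    rw [M.stateProb_eq_Pmat_pow σ _ habs (isDist_diracD_s6 _)]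
    simp [diracD, ← Subtype.ext_iff]
  rw [← M.sum_stateProb σ (diracD u.1) n, ← Finset.sum_add_sum_compl F, add_sub_cancel_left,
    Finset.sum_subtype Fᶜ (p := fun w => w ∉ F) fun w => Finset.mem_compl]
  exact Finset.sum_congr rfl fun v _ => h v

theorem summable_Pmat_pow (habs : ∀ v ∈ F, M.Absorbing v) (hσ : σ.Memoryless)
    (hpos : ∀ v : V, 0 < M.PrReach σ (diracD v) (F : Set V)) (u v : {w : V // w ∉ F}) :
    Summable fun n => (M.Pmat σ F ^ n) u v := by
  have hev : ∀ᶠ n in Filter.atTop, ∀ u : {w : V // w ∉ F},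
      0 < ∑ v ∈ F, M.stateProb σ (diracD u.1) n v :=
    Filter.eventually_all.2 fun u =>
      (M.tendsto_sum_stateProb σ _ hσ (isDist_diracD_s6 u.1) habs).eventually_const_lt (hpos u)
  obtain ⟨N, hN⟩ := hev.exists
  refine (M.Pmat σ F).summable_pow_of_rowSum_lt_one (M.Pmat_pow_nonneg σ F)
    (fun n u => ?_) (N := N) (fun u => ?_) u v
  · rw [M.sum_Pmat_pow σ habs]
    exact sub_le_self _ (Finset.sum_nonneg fun v _ => measureReal_nonneg)
  · rw [M.sum_Pmat_pow σ habs]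
    exact sub_lt_self _ (hN u)

theorem hasSum_stateProb (habs : ∀ v ∈ F, M.Absorbing v) (hα : IsDist α)
    (hσ : σ.Memoryless)
    (hpos : ∀ v : V, 0 < M.PrReach σ (diracD v) (F : Set V)) (v : {w : V // w ∉ F}) :
    HasSum (fun n => M.stateProb σ α n v)
      (∑ u : {w : V // w ∉ F}, α u * ∑' n, (M.Pmat σ F ^ n) u v) := by
  simp only [M.stateProb_eq_Pmat_pow σ α habs hα]
  exact hasSum_sum fun u _ => (M.summable_Pmat_pow σ habs hσ hpos u v).hasSum.mul_left _

omit [Nonempty V] [Nonempty A] [MeasurableSpace V] [MeasurableSingletonClass V]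
  [MeasurableSpace A] [MeasurableSingletonClass A] in
theorem sum_p_mul_yvisit (w : {w : V // w ∉ F}) (v : V) :
    ∑ a ∈ M.enabled w, M.p w a v * M.yvisit σ F α w a =
      (∑ u : {w : V // w ∉ F}, α u * ∑' n, (M.Pmat σ F ^ n) u w) * M.transProb σ w v := by
  rw [transProb, Finset.mul_sum]
  refine Finset.sum_congr rfl fun a _ => ?_
  simp only [yvisit, dif_neg w.2, tsum_mul_right, ← mul_assoc, ← Finset.sum_mul]
  ring

theorem PrReach_singleton_eq_yvisitF (habs : ∀ v ∈ F, M.Absorbing v) (hα : IsDist α)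
    (hsupp : ∀ v ∈ F, α v = 0) (hσ : σ.Memoryless)
    (hpos : ∀ v : V, 0 < M.PrReach σ (diracD v) (F : Set V)) {v : V} (hv : v ∈ F) :
    M.PrReach σ α {v} = M.yvisitF σ F α v := by
  have hlim := M.tendsto_sum_stateProb σ α hσ hα (S := {v})
    fun w hw => habs w (Finset.mem_singleton.1 hw ▸ hv)
  simp only [Finset.sum_singleton, Finset.coe_singleton] at hlim
  have hstep (n : ℕ) : M.stateProb σ α (n + 1) v = M.stateProb σ α n v +
      ∑ w : {w : V // w ∉ F}, M.stateProb σ α n w * M.transProb σ w v := by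
    rw [M.stateProb_succ σ α hα, ← Finset.sum_add_sum_compl F,
      Finset.sum_subtype Fᶜ (p := fun w => w ∉ F) fun w => Finset.mem_compl,
      Finset.sum_eq_single_of_mem v hv, (habs v hv).transProb_self, mul_one]
    intro w hw hne
    rw [(habs w hw).transProb_eq_zero σ hne.symm, mul_zero]
  have hsum (n : ℕ) : M.stateProb σ α n v = ∑ m ∈ Finset.range n,
      ∑ w : {w : V // w ∉ F}, M.stateProb σ α m w * M.transProb σ w v := by
    induction n with
    | zero => simp [M.stateProb_zero σ α hα, hsupp v hv]
    | succ n ih => rw [hstep, ih, Finset.sum_range_succ]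
  have hflow : HasSum (fun m => ∑ w : {w : V // w ∉ F},
      M.stateProb σ α m w * M.transProb σ w v) (M.yvisitF σ F α v) := by
    rw [yvisitF, Finset.sum_subtype Fᶜ (p := fun w => w ∉ F) fun w => Finset.mem_compl]
    simp only [sum_p_mul_yvisit]
    exact hasSum_sum fun w _ =>
      (M.hasSum_stateProb σ α habs hα hσ hpos w).mul_right _
  refine tendsto_nhds_unique hlim ?_
  simpa only [← hsum] using hflow.tendsto_sum_nat

omit [DecidableEq V] in
theorem PrReach_eq_sum_singleton (hσ : σ.Memoryless) (hα : IsDist α) {S : Finset V}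
    (hS : ∀ v ∈ S, M.Absorbing v) :
    M.PrReach σ α (S : Set V) = ∑ v ∈ S, M.PrReach σ α {v} := by
  refine tendsto_nhds_unique (M.tendsto_sum_stateProb σ α hσ hα hS)
    (tendsto_finsetSum _ fun v hv => ?_)
  have h := M.tendsto_sum_stateProb σ α hσ hα (S := {v})
    fun w hw => hS w (Finset.mem_singleton.1 hw ▸ hv)
  simpa using h

end Reach

end MDP

open MDP in
/-- For an MDP with absorbing targets, initial distribution `α` on `V ∖ F`, and a
memoryless strategy `σ` reaching `F` with positive probability from every state, the
probability of ever reaching a target state `v ∈ F` equals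
`∑_{v' ∈ V∖F} ∑_{γ'} p_{(v',γ',v)} y'_{(v',γ')}`, and consequently
`Pr^σ_α(◇F_i) = ∑_{v ∈ F_i} y'_v` for every `i`. -/
theorem reach_prob_eq_expected_flow
    {V A : Type} [Fintype V] [Fintype A] [Nonempty V] [Nonempty A] [DecidableEq V]
    (M : MDP V A) {k : ℕ} (Fi : Fin k → Finset V) (F : Finset V)
    (hF : F = Finset.univ.biUnion Fi)
    (habs : ∀ v ∈ F, M.Absorbing v)
    (α : V → ℝ) (hα : IsDist α) (hsupp : ∀ v ∈ F, α v = 0)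
    (σ : M.Strategy) (hσ : σ.Memoryless)
    (hpos : ∀ v : V, 0 < M.PrReach σ (diracD v) (↑F : Set V)) :
    (∀ v ∈ F, M.PrReach σ α ({v} : Set V) =
      ∑ v' ∈ Fᶜ, ∑ a' ∈ M.enabled v', M.p v' a' v * M.yvisit σ F α v' a') ∧
    (∀ i, M.PrReach σ α (↑(Fi i) : Set V) = ∑ v ∈ Fi i, M.yvisitF σ F α v) := by
  let _ : MeasurableSpace V := ⊤
  let _ : MeasurableSpace A := ⊤
  have hsub (i : Fin k) {v : V} (hv : v ∈ Fi i) : v ∈ F := by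
    rw [hF]
    exact Finset.mem_biUnion.2 ⟨i, Finset.mem_univ i, hv⟩
  have hsingle {v : V} (hv : v ∈ F) : M.PrReach σ α {v} = M.yvisitF σ F α v :=
    M.PrReach_singleton_eq_yvisitF σ α habs hα hsupp hσ hpos hv
  refine ⟨fun v hv => hsingle hv, fun i => ?_⟩
  rw [M.PrReach_eq_sum_singleton σ α hσ hα fun v hv => habs v (hsub i hv)]
  exact Finset.sum_congr rfl fun v hv => hsingle (hsub i hv)
end
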